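/- arXiv:math/0606672 — 5 statements merged into one kernel-verified Lean document; each statement's English description precedes it below -/
import Mathlib

section
/- Let K and H be complex Hilbert spaces and let F be a function from the open unit disc 𝔻 into B(K,H) that is analytic on 𝔻 and satisfies ‖F(z)‖ ≤ 1 for every z ∈ 𝔻. Then for every pair of points z₁, z₂ ∈ 𝔻, the block operator on the Hilbert space direct sum H ⊕ H given by the 2×2 operator matrix [[ (1−|z₁|²)⁻¹·(I_H − F(z₁)F(z₁)*), (1 − z₁·conj(z₂))⁻¹·(I_H − F(z₁)F(z₂)*) ], [ (1 − z₂·conj(z₁))⁻¹·(I_H − F(z₂)F(z₁)*), (1−|z₂|²)⁻¹·(I_H − F(z₂)F(z₂)*) ]] is a positive operator. -/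
open ContinuousLinearMap

open scoped InnerProductSpace ComplexConjugate ComplexOrder

/-- A combination `∑ i, k_{w i} • h i` of Szegő kernels of the disc of radius `R`, where
`k_w z = R² / (R² - z * conj w)`. -/
noncomputable def szegoSum {ι E : Type*} [Fintype ι] [NormedAddCommGroup E] [NormedSpace ℂ E]
    (R : ℝ) (w : ι → ℂ) (h : ι → E) (z : ℂ) : E :=
  ∑ i, ((R : ℂ) ^ 2 / ((R : ℂ) ^ 2 - z * conj (w i))) • h i

theorem sq_sub_mul_conj_ne_zero {R : ℝ} {z w : ℂ} (hz : ‖z‖ ≤ R) (hw : ‖w‖ < R) :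
    (R : ℂ) ^ 2 - z * conj w ≠ 0 := by
  intro h
  have hR : 0 < R := (norm_nonneg w).trans_lt hw
  have h' : R ^ 2 = ‖z‖ * ‖w‖ := by
    have := congrArg norm (sub_eq_zero.mp h)
    simpa using this
  nlinarith [norm_nonneg z, norm_nonneg w, mul_le_mul_of_nonneg_right hz (norm_nonneg w)]

section

variable {ι E : Type*} [Fintype ι] [NormedAddCommGroup E] [InnerProductSpace ℂ E]
  {R : ℝ} {w : ι → ℂ}

theorem differentiableOn_szegoSum (hw : ∀ i, ‖w i‖ < R) (h : ι → E) :
    DifferentiableOn ℂ (szegoSum R w h) (Metric.closedBall 0 R) := by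
  unfold szegoSum
  refine DifferentiableOn.fun_sum fun i _ => DifferentiableOn.smul_const ?_ _
  refine (differentiableOn_const _).div (by fun_prop) fun z hz => ?_
  exact sq_sub_mul_conj_ne_zero (by simpa using hz) (hw i)

/-- The reproducing property of the Szegő kernel. -/
theorem circleAverage_inner_szegoSum (hR : 0 < R) (hw : ∀ i, ‖w i‖ < R) (h : ι → E) {φ : ℂ → E}
    (hφ : DifferentiableOn ℂ φ (Metric.closedBall 0 R)) :
    Real.circleAverage (fun z => ⟪szegoSum R w h z, φ z⟫_ℂ) 0 R = ∑ i, ⟪h i, φ (w i)⟫_ℂ := by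
  have hinner (i : ι) : DifferentiableOn ℂ (fun z => ⟪h i, φ z⟫_ℂ) (Metric.closedBall 0 R) :=
    (innerSL ℂ (h i)).differentiable.comp_differentiableOn hφ
  have hne (i : ι) (z : ℂ) (hz : z ∈ Metric.sphere (0 : ℂ) R) : z - w i ≠ 0 := by
    intro h0
    have := hw i
    rw [← sub_eq_zero.mp h0, mem_sphere_zero_iff_norm.mp hz] at this
    exact this.false
  have hsphere : Set.EqOn (fun z => ⟪szegoSum R w h z, φ z⟫_ℂ)
      (fun z => ∑ i, ((z - 0) / (z - w i)) • ⟪h i, φ z⟫_ℂ) (Metric.sphere 0 |R|) := by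
    intro z hz
    rw [abs_of_pos hR] at hz
    simp only [szegoSum, sum_inner, inner_smul_left, smul_eq_mul]
    refine Finset.sum_congr rfl fun i _ => ?_
    congr 1
    have hz' : z * conj z = (R : ℂ) ^ 2 := by
      rw [Complex.mul_conj', mem_sphere_zero_iff_norm.mp hz]
    have h1 := sq_sub_mul_conj_ne_zero (mem_sphere_zero_iff_norm.mp hz).le (hw i)
    have h2 := (map_ne_zero conj).mpr h1
    simp only [map_div₀, map_sub, map_mul, map_pow, Complex.conj_ofReal, Complex.conj_conj,
      sub_zero] at h2 ⊢
    rw [div_eq_div_iff h2 (hne i z hz), ← hz']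
    ring
  rw [Real.circleAverage_congr_sphere hsphere, Real.circleAverage_fun_sum]
  · refine Finset.sum_congr rfl fun i _ => ?_
    refine DiffContOnCl.circleAverage_smul_div (f := fun z => ⟪h i, φ z⟫_ℂ) ?_ ?_
    · rw [abs_of_pos hR]
      exact DifferentiableOn.diffContOnCl ((hinner i).mono Metric.closure_ball_subset_closedBall)
    · simpa [abs_of_pos hR] using hw i
  · intro i _
    refine ContinuousOn.circleIntegrable hR.le (ContinuousOn.fun_smul ?_
      ((hinner i).continuousOn.mono Metric.sphere_subset_closedBall))
    exact ContinuousOn.div (by fun_prop) (by fun_prop) (hne i)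

end

section

variable {ι H K : Type*} [Fintype ι]
  [NormedAddCommGroup H] [InnerProductSpace ℂ H] [CompleteSpace H]
  [NormedAddCommGroup K] [InnerProductSpace ℂ K] [CompleteSpace K]
  {F : ℂ → (K →L[ℂ] H)}

theorem re_sum_sq_div_mul_inner_sub_inner_adjoint_nonneg {R : ℝ} (hR : 0 < R)
    (hF : DifferentiableOn ℂ F (Metric.closedBall 0 R))
    (hFnorm : ∀ z ∈ Metric.sphere (0 : ℂ) R, ‖F z‖ ≤ 1)
    {w : ι → ℂ} (hw : ∀ i, ‖w i‖ < R) (h : ι → H) :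
    0 ≤ (∑ i, ∑ j, (R : ℂ) ^ 2 / ((R : ℂ) ^ 2 - w i * conj (w j)) *
      (⟪h i, h j⟫_ℂ - ⟪adjoint (F (w i)) (h i), adjoint (F (w j)) (h j)⟫_ℂ)).re := by
  set v : ι → K := fun i => adjoint (F (w i)) (h i) with hv
  set f := szegoSum R w h
  set g := szegoSum R w v with hg
  have hf' := differentiableOn_szegoSum hw h
  have hg' := differentiableOn_szegoSum hw v
  have hFg : DifferentiableOn ℂ (fun z => F z (g z)) (Metric.closedBall 0 R) := hF.clm_apply hg'
  have ef := circleAverage_inner_szegoSum hR hw h hf'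
  have eg := circleAverage_inner_szegoSum hR hw v hg'
  have eFg := circleAverage_inner_szegoSum hR hw h hFg
  have key : ∑ i, ⟪h i, F (w i) (g (w i))⟫_ℂ = ∑ i, ⟪v i, g (w i)⟫_ℂ := by
    simp only [hv, adjoint_inner_left]
  have hff : CircleIntegrable (fun z => ⟪f z, f z⟫_ℂ) 0 R :=
    ContinuousOn.circleIntegrable hR.le
      ((hf'.continuousOn.inner hf'.continuousOn).mono Metric.sphere_subset_closedBall)
  have hgg : CircleIntegrable (fun z => ⟪g z, g z⟫_ℂ) 0 R :=
    ContinuousOn.circleIntegrable hR.le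
      ((hg'.continuousOn.inner hg'.continuousOn).mono Metric.sphere_subset_closedBall)
  have hfg : CircleIntegrable (fun z => ⟪f z, F z (g z)⟫_ℂ) 0 R :=
    ContinuousOn.circleIntegrable hR.le
      ((hf'.continuousOn.inner hFg.continuousOn).mono Metric.sphere_subset_closedBall)
  have hS : ∑ i, ∑ j, (R : ℂ) ^ 2 / ((R : ℂ) ^ 2 - w i * conj (w j)) *
        (⟪h i, h j⟫_ℂ - ⟪v i, v j⟫_ℂ)
      = Real.circleAverage ((fun z => ⟪f z, f z⟫_ℂ) + (fun z => ⟪g z, g z⟫_ℂ) -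
          ((fun z => ⟪f z, F z (g z)⟫_ℂ) + (fun z => ⟪f z, F z (g z)⟫_ℂ))) 0 R := by
    rw [Real.circleAverage_sub (hff.add hgg) (hfg.add hfg),
      Real.circleAverage_add hff hgg, Real.circleAverage_add hfg hfg,
      ef, eg, eFg, key, add_sub_add_right_eq_sub, ← Finset.sum_sub_distrib]
    refine Finset.sum_congr rfl fun i _ => ?_
    simp only [szegoSum, hg, inner_sum, inner_smul_right, ← Finset.sum_sub_distrib, mul_sub]
  rw [hS, ← Complex.reCLM_apply,
    ← Complex.reCLM.circleAverage_comp_comm ((hff.add hgg).sub (hfg.add hfg))]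
  refine Real.circleAverage_nonneg_of_nonneg fun z hz => ?_
  rw [abs_of_pos hR] at hz
  have h1 : ‖F z (g z)‖ ≤ ‖g z‖ := by
    simpa using (F z).le_of_opNorm_le (hFnorm z hz) (g z)
  have h2 : RCLike.re ⟪f z, F z (g z)⟫_ℂ ≤ ‖f z‖ * ‖F z (g z)‖ := re_inner_le_norm _ _
  have h3 : RCLike.re ⟪f z, f z⟫_ℂ = ‖f z‖ ^ 2 := inner_self_eq_norm_sq _
  have h4 : RCLike.re ⟪g z, g z⟫_ℂ = ‖g z‖ ^ 2 := inner_self_eq_norm_sq _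
  simp only [RCLike.re_to_complex] at h2 h3 h4
  simp only [Function.comp, Pi.sub_apply, Pi.add_apply, Complex.reCLM_apply, Complex.sub_re,
    Complex.add_re, h3, h4]
  nlinarith [sq_nonneg (‖f z‖ - ‖g z‖), mul_le_mul_of_nonneg_left h1 (norm_nonneg (f z))]

/-- The Pick kernel of a contractive analytic operator function on the disc is positive. -/
theorem sum_pick_kernel_nonneg (hF : DifferentiableOn ℂ F (Metric.ball 0 1))
    (hFnorm : ∀ z ∈ Metric.ball (0 : ℂ) 1, ‖F z‖ ≤ 1)
    {w : ι → ℂ} (hw : ∀ i, w i ∈ Metric.ball (0 : ℂ) 1) (h : ι → H) :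
    0 ≤ ∑ i, ∑ j, (1 - w i * conj (w j))⁻¹ *
      (⟪h i, h j⟫_ℂ - ⟪adjoint (F (w i)) (h i), adjoint (F (w j)) (h j)⟫_ℂ) := by
  refine Complex.nonneg_iff.mpr ⟨?_, ?_⟩
  · have hlim : Filter.Tendsto (fun R : ℝ => (∑ i, ∑ j,
        (R : ℂ) ^ 2 / ((R : ℂ) ^ 2 - w i * conj (w j)) *
        (⟪h i, h j⟫_ℂ - ⟪adjoint (F (w i)) (h i), adjoint (F (w j)) (h j)⟫_ℂ)).re)
        (nhdsWithin 1 (Set.Iio 1)) (nhds (∑ i, ∑ j, (1 - w i * conj (w j))⁻¹ *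
          (⟪h i, h j⟫_ℂ - ⟪adjoint (F (w i)) (h i), adjoint (F (w j)) (h j)⟫_ℂ)).re) := by
      refine (Complex.continuous_re.tendsto _).comp ?_
      refine tendsto_finsetSum _ fun i _ => tendsto_finsetSum _ fun j _ =>
        Filter.Tendsto.mul_const _ ?_
      have hc : ContinuousAt (fun R : ℝ => (R : ℂ) ^ 2 / ((R : ℂ) ^ 2 - w i * conj (w j))) 1 := by
        refine ContinuousAt.div (by fun_prop) (by fun_prop) ?_
        exact sq_sub_mul_conj_ne_zero (mem_ball_zero_iff.mp (hw i)).le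
          (mem_ball_zero_iff.mp (hw j))
      simpa using hc.tendsto.mono_left nhdsWithin_le_nhds
    refine ge_of_tendsto hlim ?_
    have hev : ∀ᶠ R in nhdsWithin (1 : ℝ) (Set.Iio 1), ∀ i, ‖w i‖ < R :=
      Filter.eventually_all.mpr fun i => nhdsWithin_le_nhds
        (eventually_gt_nhds (mem_ball_zero_iff.mp (hw i)))
    filter_upwards [hev, self_mem_nhdsWithin,
      nhdsWithin_le_nhds (eventually_gt_nhds zero_lt_one)] with R hwR hR1 hR0
    have hsub : Metric.closedBall (0 : ℂ) R ⊆ Metric.ball 0 1 :=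
      Metric.closedBall_subset_ball hR1
    exact re_sum_sq_div_mul_inner_sub_inner_adjoint_nonneg hR0 (hF.mono hsub)
      (fun z hz => hFnorm z (hsub (Metric.sphere_subset_closedBall hz))) hwR h
  · refine (Complex.conj_eq_iff_im.mp ?_).symm
    simp only [map_sum, map_mul, map_inv₀, map_sub, map_one, Complex.conj_conj, inner_conj_symm]
    rw [Finset.sum_comm]
    simp only [mul_comm]

end

/-- **Pick-type positivity for contractive analytic operator functions.**
If `F : 𝔻 → B(K,H)` is analytic with `‖F z‖ ≤ 1` on the open unit disc, then for any
`z₁ z₂ ∈ 𝔻` the 2×2 block operator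
`[[(1-|z₁|²)⁻¹(I - F(z₁)F(z₁)*), (1-z₁ z̄₂)⁻¹(I - F(z₁)F(z₂)*)],
  [(1-z₂ z̄₁)⁻¹(I - F(z₂)F(z₁)*), (1-|z₂|²)⁻¹(I - F(z₂)F(z₂)*)]]`
on `H ⊕ H` is positive. -/
theorem stmt0
    {H K : Type*} [NormedAddCommGroup H] [InnerProductSpace ℂ H] [CompleteSpace H]
    [NormedAddCommGroup K] [InnerProductSpace ℂ K] [CompleteSpace K]
    (F : ℂ → (K →L[ℂ] H))
    (hFdiff : DifferentiableOn ℂ F (Metric.ball 0 1))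
    (hFnorm : ∀ z ∈ Metric.ball (0 : ℂ) 1, ‖F z‖ ≤ 1)
    {z₁ z₂ : ℂ} (hz₁ : z₁ ∈ Metric.ball (0 : ℂ) 1) (hz₂ : z₂ ∈ Metric.ball (0 : ℂ) 1) :
    -- the `(i,j)` entry of the block operator matrix:
    let T : ℂ → ℂ → (H →L[ℂ] H) := fun a b =>
      ((1 : ℂ) - a * (starRingEnd ℂ) b)⁻¹ •
        ((1 : H →L[ℂ] H) - (F a) ∘L (ContinuousLinearMap.adjoint (F b)))
    ContinuousLinearMap.IsPositive
      (((WithLp.prodContinuousLinearEquiv 2 ℂ H H).symm : (H × H) →L[ℂ] WithLp 2 (H × H)) ∘L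
        ((((T z₁ z₁ ∘L ContinuousLinearMap.fst ℂ H H) +
            (T z₁ z₂ ∘L ContinuousLinearMap.snd ℂ H H)).prod
          ((T z₂ z₁ ∘L ContinuousLinearMap.fst ℂ H H) +
            (T z₂ z₂ ∘L ContinuousLinearMap.snd ℂ H H))) ∘L
          ((WithLp.prodContinuousLinearEquiv 2 ℂ H H) : WithLp 2 (H × H) →L[ℂ] (H × H)))) := by
  intro T
  rw [ContinuousLinearMap.isPositive_iff_complex]
  intro x
  have hpos := sum_pick_kernel_nonneg hFdiff hFnorm (w := ![z₁, z₂])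
    (Fin.forall_fin_two.mpr ⟨hz₁, hz₂⟩) ![x.fst, x.snd]
  have hT (a b : ℂ) (u v : H) : ⟪u, T a b v⟫_ℂ = (1 - a * conj b)⁻¹ *
      (⟪u, v⟫_ℂ - ⟪adjoint (F a) u, adjoint (F b) v⟫_ℂ) := by
    simp only [T, smul_apply, sub_apply, one_apply_eq_self, comp_apply, inner_smul_right,
      inner_sub_right, adjoint_inner_left]
  simp only [Fin.sum_univ_two, Matrix.cons_val_zero, Matrix.cons_val_one, ← hT,
    ← inner_add_right] at hpos
  have hx : ⟪x.fst, T z₁ z₁ x.fst + T z₁ z₂ x.snd⟫_ℂ + ⟪x.snd, T z₂ z₁ x.fst + T z₂ z₂ x.snd⟫_ℂ =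
      ⟪x, WithLp.toLp 2 (T z₁ z₁ x.fst + T z₁ z₂ x.snd, T z₂ z₁ x.fst + T z₂ z₂ x.snd)⟫_ℂ := rfl
  rw [hx, ← star_nonneg_iff, ← starRingEnd_apply, inner_conj_symm] at hpos
  obtain ⟨hre, him⟩ := RCLike.nonneg_iff.mp hpos
  exact ⟨RCLike.conj_eq_iff_re.mp (RCLike.conj_eq_iff_im.mpr him), hre⟩
end

section
/- Let K and H be complex Hilbert spaces and let F : 𝔻 → B(K,H) be analytic on 𝔻 with ‖F(z)‖ ≤ 1 for all z ∈ 𝔻. Suppose P₁, P₂ are orthogonal projections on H with P₁ + P₂ = I_H, and Q₁, Q₂ are orthogonal projections on K with Q₁ + Q₂ = I_K, satisfying: (i) P₁F(0)Q₂ = 0 and P₂F(0)Q₁ = 0; (ii) P₁F(0)F(0)*P₁ = P₁; (iii) P₂F(0)F(0)*P₂ ≤ r·P₂ for some real r with 0 < r < 1. Then for every z ∈ 𝔻: (1) P₁F(z)Q₂ = 0; (2) P₁F(z)Q₁ = P₁F(0)Q₁; and (3) there exists a real number q₀(z) with 0 < q₀(z) < 1 such that P₂F(z)F(z)*P₂ ≤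 q₀(z)·P₂. -/
open ContinuousLinearMap

/-- A weak form of the **Schwarz-Pick lemma** for scalar functions on the unit disc. -/
theorem Complex.norm_sq_le_of_norm_le_one_of_norm_zero_le {g : ℂ → ℂ} {a : ℝ} {z : ℂ}
    (hd : DifferentiableOn ℂ g (Metric.ball 0 1)) (hg : ∀ w ∈ Metric.ball (0 : ℂ) 1, ‖g w‖ ≤ 1)
    (ha : ‖g 0‖ ≤ a) (ha1 : a < 1) (hz : ‖z‖ < 1) :
    ‖g z‖ ^ 2 ≤ 1 - (1 - ‖z‖ ^ 2) * ((1 - a) / (1 + a)) := by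
  have hc1 : ‖g 0‖ < 1 := ha.trans_lt ha1
  have ha0 : 0 ≤ a := (norm_nonneg _).trans ha
  set c := g 0 with hc
  have identity (w : ℂ) : ‖1 - starRingEnd ℂ c * w‖ ^ 2 - ‖w - c‖ ^ 2 =
      (1 - ‖w‖ ^ 2) * (1 - ‖c‖ ^ 2) := by
    simp only [Complex.sq_norm, Complex.normSq_apply, Complex.sub_re, Complex.sub_im,
      Complex.mul_re, Complex.mul_im, Complex.conj_re, Complex.conj_im, Complex.one_re,
      Complex.one_im]
    ring
  have lower {w : ℂ} (hw : ‖w‖ ≤ 1) : 1 - ‖c‖ ≤ ‖1 - starRingEnd ℂ c * w‖ := by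
    have h := norm_sub_norm_le (1 : ℂ) (starRingEnd ℂ c * w)
    rw [norm_one, norm_mul, RCLike.norm_conj] at h
    nlinarith [norm_nonneg c]
  have den_ne {w : ℂ} (hw : ‖w‖ ≤ 1) : 1 - starRingEnd ℂ c * w ≠ 0 :=
    norm_pos_iff.1 ((sub_pos.2 hc1).trans_le (lower hw))
  have schwarz : ‖(g z - c) / (1 - starRingEnd ℂ c * g z)‖ ≤ ‖z‖ := by
    refine Complex.norm_le_norm_of_mapsTo_ball (R := 1)
      (f := fun w ↦ (g w - c) / (1 - starRingEnd ℂ c * g w)) ?_ ?_ (by simp [hc]) hz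
    · exact (hd.sub_const c).div ((hd.const_mul _).const_sub 1) fun w hw ↦ den_ne (hg w hw)
    · intro w hw
      rw [mem_closedBall_zero_iff, norm_div]
      refine div_le_one_of_le₀ (le_of_sq_le_sq ?_ (norm_nonneg _)) (norm_nonneg _)
      have hw1 : 0 ≤ 1 - ‖g w‖ ^ 2 := by nlinarith [hg w hw, norm_nonneg (g w)]
      nlinarith [identity (g w), mul_nonneg hw1 (show 0 ≤ 1 - ‖c‖ ^ 2 by
        nlinarith [norm_nonneg c])]
  have hgz : ‖g z‖ ≤ 1 := hg z (mem_ball_zero_iff.2 hz)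
  have hden := lower hgz
  rw [norm_div, div_le_iff₀ ((sub_pos.2 hc1).trans_le hden)] at schwarz
  have hz2 : 0 ≤ 1 - ‖z‖ ^ 2 := by nlinarith [norm_nonneg z]
  have key : (1 - ‖z‖ ^ 2) * (1 - ‖c‖) ^ 2 ≤ (1 - ‖g z‖ ^ 2) * (1 - ‖c‖ ^ 2) :=
    calc (1 - ‖z‖ ^ 2) * (1 - ‖c‖) ^ 2
        ≤ (1 - ‖z‖ ^ 2) * ‖1 - starRingEnd ℂ c * g z‖ ^ 2 := by
          have := sub_nonneg.2 hc1.le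
          gcongr
      _ ≤ ‖1 - starRingEnd ℂ c * g z‖ ^ 2 - ‖g z - c‖ ^ 2 := by
          have := pow_le_pow_left₀ (norm_nonneg _) schwarz 2
          rw [mul_pow] at this
          linarith
      _ = _ := identity (g z)
  have key' : (1 - ‖z‖ ^ 2) * (1 - ‖c‖) ≤ (1 - ‖g z‖ ^ 2) * (1 + ‖c‖) :=
    le_of_mul_le_mul_right (by linarith) (sub_pos.2 hc1)
  have ratio_le : (1 - a) / (1 + a) ≤ (1 - ‖c‖) / (1 + ‖c‖) := by gcongr
  have bound : (1 - ‖z‖ ^ 2) * ((1 - ‖c‖) / (1 + ‖c‖)) ≤ 1 - ‖g z‖ ^ 2 := by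
    rwa [mul_div_assoc', div_le_iff₀ (by positivity)]
  linarith [mul_le_mul_of_nonneg_left ratio_le hz2]

/-- A bounded analytic function on the unit disc, with values in a normed space, which has norm
less than the bound at the origin satisfies a strict bound at every point. -/
theorem norm_sq_le_of_norm_le_one_of_norm_zero_le {E : Type*} [NormedAddCommGroup E]
    [NormedSpace ℂ E] {f : ℂ → E} {a : ℝ} {z : ℂ}
    (hd : DifferentiableOn ℂ f (Metric.ball 0 1)) (hf : ∀ w ∈ Metric.ball (0 : ℂ) 1, ‖f w‖ ≤ 1)
    (ha : ‖f 0‖ ≤ a) (ha1 : a < 1) (hz : ‖z‖ < 1) :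
    ‖f z‖ ^ 2 ≤ 1 - (1 - ‖z‖ ^ 2) * ((1 - a) / (1 + a)) := by
  obtain ⟨φ, hφ, hφz⟩ := exists_dual_vector'' ℂ (f z)
  have hle (w : ℂ) : ‖φ (f w)‖ ≤ ‖f w‖ := by
    simpa using φ.le_of_opNorm_le hφ (f w)
  have h := Complex.norm_sq_le_of_norm_le_one_of_norm_zero_le (g := fun w ↦ φ (f w))
    (φ.differentiable.comp_differentiableOn hd) (fun w hw ↦ (hle w).trans (hf w hw))
    ((hle 0).trans ha) ha1 hz
  simpa [hφz] using h

section Hilbert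

variable {H K : Type*} [NormedAddCommGroup H] [InnerProductSpace ℂ H] [CompleteSpace H]
  [NormedAddCommGroup K] [InnerProductSpace ℂ K] [CompleteSpace K]

/-- If the adjoint of a contractive analytic function preserves the norm of `x` at the origin,
then it is constant at `x`. -/
theorem adjoint_apply_eq_of_norm_adjoint_apply_zero_eq {F : ℂ → (K →L[ℂ] H)}
    (hd : DifferentiableOn ℂ F (Metric.ball 0 1)) (hF : ∀ z ∈ Metric.ball (0 : ℂ) 1, ‖F z‖ ≤ 1)
    {x : H} (hx : ‖adjoint (F 0) x‖ = ‖x‖) {z : ℂ} (hz : z ∈ Metric.ball (0 : ℂ) 1) :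
    adjoint (F z) x = adjoint (F 0) x := by
  have h0 : (0 : ℂ) ∈ Metric.ball (0 : ℂ) 1 := Metric.mem_ball_self one_pos
  set u := adjoint (F 0) x with hu
  have hle (w : ℂ) (hw : w ∈ Metric.ball (0 : ℂ) 1) : ‖F w u‖ ≤ ‖x‖ := by
    simpa [hx] using (F w).le_of_opNorm_le (hF w hw) u
  have hF0 : F 0 u = x := by
    refine eq_of_norm_le_re_inner_eq_norm_sq (𝕜 := ℂ) (hle 0 h0) ?_
    rw [← adjoint_inner_right, ← hu, inner_self_eq_norm_sq, hx]
  let _ : InnerProductSpace ℝ H := InnerProductSpace.rclikeToReal ℂ H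
  have hFz : F z u = F 0 u :=
    Complex.eqOn_of_isPreconnected_of_isMaxOn_norm (f := fun w ↦ F w u)
      (convex_ball (0 : ℂ) 1).isPreconnected Metric.isOpen_ball
      (hd.clm_apply (differentiableOn_const u)) h0
      (fun w hw ↦ by simpa [hF0] using hle w hw) hz
  refine eq_of_norm_le_re_inner_eq_norm_sq (𝕜 := ℂ) ?_ ?_
  · simpa [hx] using (adjoint (F z)).le_of_opNorm_le
      ((LinearIsometryEquiv.norm_map adjoint (F z)).trans_le (hF z hz)) x
  · rw [adjoint_inner_left, hFz, hF0, inner_self_eq_norm_sq, hx]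

theorem inner_comp_adjoint_comp_apply_self {P : H →L[ℂ] H} (hP : IsSelfAdjoint P)
    (A : K →L[ℂ] H) (x : H) :
    inner ℂ ((P ∘L A ∘L adjoint A ∘L P) x) x = ((‖adjoint A (P x)‖ ^ 2 : ℝ) : ℂ) := by
  have h := hP.isSymmetric (A (adjoint A (P x))) x
  simp only [coe_coe] at h
  simp only [comp_apply, h]
  rw [← adjoint_inner_right, inner_self_eq_norm_sq_to_K]
  norm_cast

theorem inner_apply_self_of_isSelfAdjoint_of_comp_self {P : H →L[ℂ] H} (hP : IsSelfAdjoint P)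
    (hPP : P ∘L P = P) (x : H) : inner ℂ (P x) x = ((‖P x‖ ^ 2 : ℝ) : ℂ) := by
  have h := hP.isSymmetric (P x) x
  simp only [coe_coe, ← comp_apply, hPP] at h
  rw [h, inner_self_eq_norm_sq_to_K]
  norm_cast

theorem isPositive_smul_sub_comp_adjoint_comp_iff {P : H →L[ℂ] H} (hP : IsSelfAdjoint P)
    (hPP : P ∘L P = P) (A : K →L[ℂ] H) (c : ℝ) :
    ((c : ℂ) • P - P ∘L A ∘L adjoint A ∘L P).IsPositive ↔
      ∀ x, ‖adjoint A (P x)‖ ^ 2 ≤ c * ‖P x‖ ^ 2 := by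
  have h (x : H) : inner ℂ (((c : ℂ) • P - P ∘L A ∘L adjoint A ∘L P) x) x =
      ((c * ‖P x‖ ^ 2 - ‖adjoint A (P x)‖ ^ 2 : ℝ) : ℂ) := by
    rw [sub_apply, inner_sub_left, inner_comp_adjoint_comp_apply_self hP, smul_apply,
      inner_smul_left, inner_apply_self_of_isSelfAdjoint_of_comp_self hP hPP]
    simp
  simp only [isPositive_iff_complex, h, RCLike.re_to_complex, Complex.ofReal_re, true_and,
    sub_nonneg]

end Hilbert

/-- If `F : 𝔻 → B(K,H)` is analytic and contractive, `P₁ + P₂ = I_H`, `Q₁ + Q₂ = I_K` are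
decompositions into orthogonal projections with `P₁F(0)Q₂ = 0`, `P₂F(0)Q₁ = 0`,
`P₁F(0)F(0)*P₁ = P₁` and `P₂F(0)F(0)*P₂ ≤ r P₂` for some `0 < r < 1`, then for every `z ∈ 𝔻`:
`P₁F(z)Q₂ = 0`, `P₁F(z)Q₁ = P₁F(0)Q₁`, and `P₂F(z)F(z)*P₂ ≤ q₀(z) P₂` for some `0 < q₀(z) < 1`. -/
theorem stmt1
    {H K : Type*} [NormedAddCommGroup H] [InnerProductSpace ℂ H] [CompleteSpace H]
    [NormedAddCommGroup K] [InnerProductSpace ℂ K] [CompleteSpace K]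
    (F : ℂ → (K →L[ℂ] H))
    (hFdiff : DifferentiableOn ℂ F (Metric.ball 0 1))
    (hFnorm : ∀ z ∈ Metric.ball (0 : ℂ) 1, ‖F z‖ ≤ 1)
    (P₁ P₂ : H →L[ℂ] H) (Q₁ Q₂ : K →L[ℂ] K)
    (hP₁sa : IsSelfAdjoint P₁) (hP₁idem : P₁ ∘L P₁ = P₁)
    (hP₂sa : IsSelfAdjoint P₂) (hP₂idem : P₂ ∘L P₂ = P₂)
    (hPsum : P₁ + P₂ = 1)
    (hQ₁sa : IsSelfAdjoint Q₁) (hQ₁idem : Q₁ ∘L Q₁ = Q₁)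
    (hQ₂sa : IsSelfAdjoint Q₂) (hQ₂idem : Q₂ ∘L Q₂ = Q₂)
    (hQsum : Q₁ + Q₂ = 1)
    (h_i1 : P₁ ∘L F 0 ∘L Q₂ = 0) (h_i2 : P₂ ∘L F 0 ∘L Q₁ = 0)
    (h_ii : P₁ ∘L F 0 ∘L ContinuousLinearMap.adjoint (F 0) ∘L P₁ = P₁)
    (r : ℝ) (hr0 : 0 < r) (hr1 : r < 1)
    (h_iii : ((r : ℂ) • P₂ -
        P₂ ∘L F 0 ∘L ContinuousLinearMap.adjoint (F 0) ∘L P₂).IsPositive) :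
    ∀ z ∈ Metric.ball (0 : ℂ) 1,
      P₁ ∘L F z ∘L Q₂ = 0 ∧
      P₁ ∘L F z ∘L Q₁ = P₁ ∘L F 0 ∘L Q₁ ∧
      ∃ q₀ : ℝ, 0 < q₀ ∧ q₀ < 1 ∧
        ((q₀ : ℂ) • P₂ -
          P₂ ∘L F z ∘L ContinuousLinearMap.adjoint (F z) ∘L P₂).IsPositive := by
  intro z hz
  have hz' : ‖z‖ < 1 := mem_ball_zero_iff.1 hz
  have norm_P₂_le : ‖P₂‖ ≤ 1 := IsStarProjection.norm_le P₂ ⟨hP₂idem, hP₂sa⟩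
  have adjoint_comp_P₁ : adjoint (F z) ∘L P₁ = adjoint (F 0) ∘L P₁ := by
    ext1 x
    refine adjoint_apply_eq_of_norm_adjoint_apply_zero_eq hFdiff hFnorm ?_ hz
    have h := inner_comp_adjoint_comp_apply_self hP₁sa (F 0) x
    rw [h_ii, inner_apply_self_of_isSelfAdjoint_of_comp_self hP₁sa hP₁idem] at h
    exact ((sq_eq_sq₀ (norm_nonneg _) (norm_nonneg _)).1 (Complex.ofReal_injective h)).symm
  have P₁_comp : P₁ ∘L F z = P₁ ∘L F 0 := by
    simpa [adjoint_comp, hP₁sa.adjoint_eq] using congrArg adjoint adjoint_comp_P₁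
  refine ⟨by rw [← comp_assoc, P₁_comp, comp_assoc, h_i1],
    by rw [← comp_assoc, P₁_comp, comp_assoc], ?_⟩
  have adjoint_P₂_comp (w : ℂ) : adjoint (P₂ ∘L F w) = adjoint (F w) ∘L P₂ := by
    rw [adjoint_comp, hP₂sa.adjoint_eq]
  have norm_zero_le : ‖P₂ ∘L F 0‖ ≤ √r := by
    rw [← LinearIsometryEquiv.norm_map adjoint, adjoint_P₂_comp]
    refine opNorm_le_bound _ (Real.sqrt_nonneg r) fun x ↦ ?_
    have hx := (isPositive_smul_sub_comp_adjoint_comp_iff hP₂sa hP₂idem (F 0) r).1 h_iii x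
    have hPx : ‖P₂ x‖ ≤ ‖x‖ := by simpa using P₂.le_of_opNorm_le norm_P₂_le x
    calc ‖adjoint (F 0) (P₂ x)‖ ≤ √(r * ‖P₂ x‖ ^ 2) := Real.le_sqrt_of_sq_le hx
      _ = √r * ‖P₂ x‖ := by rw [Real.sqrt_mul hr0.le, Real.sqrt_sq (norm_nonneg _)]
      _ ≤ √r * ‖x‖ := by gcongr
  have sqrt_r_pos : 0 < √r := Real.sqrt_pos.2 hr0
  have sqrt_r_lt : √r < 1 := by rwa [Real.sqrt_lt' one_pos, one_pow]
  have norm_sq_le := norm_sq_le_of_norm_le_one_of_norm_zero_le (f := fun w ↦ P₂ ∘L F w)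
    ((differentiableOn_const P₂).clm_comp hFdiff)
    (fun w hw ↦ (opNorm_comp_le _ _).trans
      (mul_le_one₀ norm_P₂_le (norm_nonneg _) (hFnorm w hw))) norm_zero_le sqrt_r_lt hz'
  have ratio_pos : 0 < (1 - √r) / (1 + √r) := div_pos (by linarith) (by linarith)
  have ratio_lt : (1 - √r) / (1 + √r) < 1 := by rw [div_lt_one (by linarith)]; linarith
  have one_sub_pos : 0 < 1 - ‖z‖ ^ 2 :=
    sub_pos.2 (pow_lt_one₀ (norm_nonneg z) hz' two_ne_zero)
  refine ⟨1 - (1 - ‖z‖ ^ 2) * ((1 - √r) / (1 + √r)), sub_pos.2 <|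
    mul_lt_one_of_nonneg_of_lt_one_right (sub_le_self _ (sq_nonneg _)) ratio_pos.le ratio_lt,
    sub_lt_self _ (mul_pos one_sub_pos ratio_pos), ?_⟩
  rw [isPositive_smul_sub_comp_adjoint_comp_iff hP₂sa hP₂idem]
  intro x
  have hx := (adjoint (P₂ ∘L F z)).le_opNorm (P₂ x)
  rw [LinearIsometryEquiv.norm_map, adjoint_P₂_comp, comp_apply, ← comp_apply P₂ P₂,
    hP₂idem] at hx
  calc ‖adjoint (F z) (P₂ x)‖ ^ 2 ≤ (‖P₂ ∘L F z‖ * ‖P₂ x‖) ^ 2 := by gcongr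
    _ = ‖P₂ ∘L F z‖ ^ 2 * ‖P₂ x‖ ^ 2 := mul_pow _ _ _
    _ ≤ _ := mul_le_mul_of_nonneg_right norm_sq_le (sq_nonneg _)
end

section
/- Let H and K be complex Hilbert spaces and let γ : H → K be a bounded linear operator with ‖γ‖ < 1. Set Δ = (I_H − γ*γ)^{1/2} ∈ B(H) and Δ_* = (I_K − γγ*)^{1/2} ∈ B(K), the positive square roots. Then I_K − γγ* and Δ_* are invertible, and the block operator W : K ⊕ H → H ⊕ K defined by the operator matrix W = [[Δγ*Δ_*⁻¹, −Δ], [Δ_*, γ]] (that is, W(k,h) = (Δγ*Δ_*⁻¹k − Δh, Δ_*k + γh)) is a unitary operator. -/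
open ContinuousLinearMap

section Intertwining

variable {H K : Type*} [NormedAddCommGroup H] [InnerProductSpace ℂ H] [CompleteSpace H]
  [NormedAddCommGroup K] [InnerProductSpace ℂ K] [CompleteSpace K]

/-- Uniqueness for the homogeneous Sylvester equation `B X + X A = 0` with `A`, `B` positive and
`A` invertible. -/
theorem ContinuousLinearMap.eq_zero_of_comp_eq_neg_comp {A : H →L[ℂ] H} {B : K →L[ℂ] K}
    (hA : A.IsPositive) (hAu : IsUnit A) (hB : B.IsPositive) {X : H →L[ℂ] K}
    (h : B ∘L X = -(X ∘L A)) : X = 0 := by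
  have hP : (adjoint X ∘L B ∘L X).IsPositive := hB.adjoint_conj X
  have hQ : (adjoint X ∘L X).IsPositive := isPositive_adjoint_comp_self X
  have hneg : adjoint X ∘L B ∘L X = -((adjoint X ∘L X) * A) := by
    rw [h]; ext x; simp
  rw [hneg] at hP
  have hsa : IsSelfAdjoint ((adjoint X ∘L X) * A) := by
    simpa using hP.isSelfAdjoint.neg
  have hcomm : Commute (adjoint X ∘L X) A :=
    (hQ.isSelfAdjoint.commute_iff hA.isSelfAdjoint).mpr hsa
  have hnonneg : 0 ≤ (adjoint X ∘L X) * A :=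
    hcomm.mul_nonneg ((nonneg_iff_isPositive _).mpr hQ) ((nonneg_iff_isPositive _).mpr hA)
  have hnonpos : (adjoint X ∘L X) * A ≤ 0 :=
    neg_nonneg.mp ((nonneg_iff_isPositive _).mpr hP)
  have hzero := hAu.mul_left_eq_zero.mp (le_antisymm hnonpos hnonneg)
  rwa [adjoint_comp_self_eq_zero_iff] at hzero

/-- If `γ` intertwines the squares of two positive operators, the first of which is invertible,
then it intertwines the operators. -/
theorem ContinuousLinearMap.comp_eq_comp_of_sq {A : H →L[ℂ] H} {B : K →L[ℂ] K}
    (hA : A.IsPositive) (hAu : IsUnit A) (hB : B.IsPositive) {γ : H →L[ℂ] K}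
    (h : γ ∘L (A ∘L A) = (B ∘L B) ∘L γ) : γ ∘L A = B ∘L γ := by
  refine sub_eq_zero.mp (eq_zero_of_comp_eq_neg_comp hA hAu hB ?_)
  ext x
  have hx := congr($h x)
  simp only [comp_apply, sub_apply, neg_apply, map_sub] at hx ⊢
  rw [hx]
  abel

end Intertwining

/-- For a strict contraction `γ : H → K` with defect operators `Δ = (I - γ*γ)^{1/2}` and
`Δ_* = (I - γγ*)^{1/2}` (characterized as the positive square roots), `I - γγ*` and `Δ_*` are
invertible and the block operator `W = [[Δγ*Δ_*⁻¹, -Δ], [Δ_*, γ]] : K ⊕ H → H ⊕ K` is unitary. -/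
theorem stmt4
    {H K : Type*} [NormedAddCommGroup H] [InnerProductSpace ℂ H] [CompleteSpace H]
    [NormedAddCommGroup K] [InnerProductSpace ℂ K] [CompleteSpace K]
    (γ : H →L[ℂ] K) (hγ : ‖γ‖ < 1)
    (Δ : H →L[ℂ] H) (hΔpos : Δ.IsPositive)
    (hΔsq : Δ ∘L Δ = 1 - ContinuousLinearMap.adjoint γ ∘L γ)
    (Δs : K →L[ℂ] K) (hΔspos : Δs.IsPositive)
    (hΔssq : Δs ∘L Δs = 1 - γ ∘L ContinuousLinearMap.adjoint γ) :
    IsUnit ((1 : K →L[ℂ] K) - γ ∘L ContinuousLinearMap.adjoint γ) ∧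
    IsUnit Δs ∧
    (let W : WithLp 2 (K × H) →L[ℂ] WithLp 2 (H × K) :=
      ((WithLp.prodContinuousLinearEquiv 2 ℂ H K).symm : (H × K) →L[ℂ] WithLp 2 (H × K)) ∘L
        ((((Δ ∘L ContinuousLinearMap.adjoint γ ∘L Ring.inverse Δs) ∘L
              ContinuousLinearMap.fst ℂ K H) -
            (Δ ∘L ContinuousLinearMap.snd ℂ K H)).prod
          ((Δs ∘L ContinuousLinearMap.fst ℂ K H) + (γ ∘L ContinuousLinearMap.snd ℂ K H))) ∘L
        ((WithLp.prodContinuousLinearEquiv 2 ℂ K H) : WithLp 2 (K × H) →L[ℂ] (K × H));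
      ContinuousLinearMap.adjoint W ∘L W = 1 ∧ W ∘L ContinuousLinearMap.adjoint W = 1) := by
  have hγ' : ‖γ‖ * ‖γ‖ < 1 := mul_lt_one_of_nonneg_of_lt_one_left (norm_nonneg _) hγ hγ.le
  have hu : IsUnit (1 - adjoint γ ∘L γ) :=
    isUnit_one_sub_of_norm_lt_one (by rwa [norm_adjoint_comp_self])
  have hus : IsUnit (1 - γ ∘L adjoint γ) := by
    refine isUnit_one_sub_of_norm_lt_one ?_
    have := norm_adjoint_comp_self (adjoint γ)
    rw [adjoint_adjoint, LinearIsometryEquiv.norm_map] at this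
    rwa [this]
  have hΔu : IsUnit Δ := isUnit_mul_self_iff.mp (hΔsq.symm ▸ hu : IsUnit (Δ ∘L Δ))
  have hΔsu : IsUnit Δs := isUnit_mul_self_iff.mp (hΔssq.symm ▸ hus : IsUnit (Δs ∘L Δs))
  have hint : γ ∘L Δ = Δs ∘L γ := by
    refine comp_eq_comp_of_sq hΔpos hΔu hΔspos ?_
    rw [hΔsq, hΔssq]
    ext x
    simp
  have hint' : Δ ∘L adjoint γ = adjoint γ ∘L Δs := by
    have := congr(adjoint $hint)
    rwa [adjoint_comp, adjoint_comp, hΔpos.isSelfAdjoint.adjoint_eq,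
      hΔspos.isSelfAdjoint.adjoint_eq] at this
  have hcorner : Δ ∘L adjoint γ ∘L Ring.inverse Δs = adjoint γ := by
    rw [← comp_assoc, hint', comp_assoc]
    change adjoint γ ∘L (Δs * Ring.inverse Δs) = _
    rw [Ring.mul_inverse_cancel _ hΔsu]
    rfl
  refine ⟨hus, hΔsu, ?_⟩
  rw [hcorner]
  intro W
  let V : WithLp 2 (H × K) →L[ℂ] WithLp 2 (K × H) :=
    ((WithLp.prodContinuousLinearEquiv 2 ℂ K H).symm : (K × H) →L[ℂ] WithLp 2 (K × H)) ∘L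
      (((γ ∘L fst ℂ H K) + (Δs ∘L snd ℂ H K)).prod
        ((adjoint γ ∘L snd ℂ H K) - (Δ ∘L fst ℂ H K))) ∘L
      ((WithLp.prodContinuousLinearEquiv 2 ℂ H K) : WithLp 2 (H × K) →L[ℂ] (H × K))
  have hV : adjoint W = V := by
    refine ((eq_adjoint_iff V W).mpr fun x y => ?_).symm
    simp only [V, W, WithLp.prod_inner_apply]
    simp [inner_add_left, inner_add_right, inner_sub_left, inner_sub_right,
      adjoint_inner_left, adjoint_inner_right, hΔpos.inner_left_eq_inner_right,
      hΔspos.inner_left_eq_inner_right]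
    ring
  have h1 (x : H) : Δ (Δ x) = x - adjoint γ (γ x) := congr($hΔsq x)
  have h2 (x : K) : Δs (Δs x) = x - γ (adjoint γ x) := congr($hΔssq x)
  have h3 (x : H) : γ (Δ x) = Δs (γ x) := congr($hint x)
  have h4 (x : K) : Δ (adjoint γ x) = adjoint γ (Δs x) := congr($hint' x)
  rw [hV]
  constructor <;>
  · refine ContinuousLinearMap.ext fun x => WithLp.ofLp_injective 2 (Prod.ext ?_ ?_) <;>
    simp [V, W, h1, h2, h3, h4] <;>
    abel
end

section
/- Let H and K be complex Hilbert spaces and let γ, z : H → K be bounded linear operators with ‖γ‖ < 1 and ‖z‖ < 1. Set Δ = (I_H − γ*γ)^{1/2} and Δ_* = (I_K − γγ*)^{1/2}. Then I_H − z*γ and Δ_* are invertible, and Δ·(I_H − z*γ)⁻¹·(γ* − z*)·Δ_*⁻¹ = Δγ*Δ_*⁻¹ − Δ·(I_H − z*γ)⁻¹·z*·Δ_*. -/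
open ContinuousLinearMap

theorem ContinuousLinearMap.opNorm_comp_lt_one {𝕜 E F G : Type*} [NontriviallyNormedField 𝕜]
    [SeminormedAddCommGroup E] [NormedSpace 𝕜 E] [SeminormedAddCommGroup F] [NormedSpace 𝕜 F]
    [SeminormedAddCommGroup G] [NormedSpace 𝕜 G] {g : F →L[𝕜] G} {f : E →L[𝕜] F}
    (hg : ‖g‖ < 1) (hf : ‖f‖ < 1) : ‖g ∘L f‖ < 1 :=
  (g.opNorm_comp_le f).trans_lt (mul_lt_one_of_nonneg_of_lt_one_left (norm_nonneg g) hg hf.le)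

/-- For strict contractions `γ, z : H → K` with defect operators `Δ = (I - γ*γ)^{1/2}` and
`Δ_* = (I - γγ*)^{1/2}` (characterized as the positive square roots), `I - z*γ` and `Δ_*` are
invertible and `Δ(I - z*γ)⁻¹(γ* - z*)Δ_*⁻¹ = Δγ*Δ_*⁻¹ - Δ(I - z*γ)⁻¹z*Δ_*`. -/
theorem stmt5
    {H K : Type*} [NormedAddCommGroup H] [InnerProductSpace ℂ H] [CompleteSpace H]
    [NormedAddCommGroup K] [InnerProductSpace ℂ K] [CompleteSpace K]
    (γ z : H →L[ℂ] K) (hγ : ‖γ‖ < 1) (hz : ‖z‖ < 1)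
    (Δ : H →L[ℂ] H) (hΔpos : Δ.IsPositive)
    (hΔsq : Δ ∘L Δ = 1 - ContinuousLinearMap.adjoint γ ∘L γ)
    (Δs : K →L[ℂ] K) (hΔspos : Δs.IsPositive)
    (hΔssq : Δs ∘L Δs = 1 - γ ∘L ContinuousLinearMap.adjoint γ) :
    IsUnit ((1 : H →L[ℂ] H) - ContinuousLinearMap.adjoint z ∘L γ) ∧
    IsUnit Δs ∧
    Δ ∘L Ring.inverse ((1 : H →L[ℂ] H) - ContinuousLinearMap.adjoint z ∘L γ) ∘L
        (ContinuousLinearMap.adjoint γ - ContinuousLinearMap.adjoint z) ∘L Ring.inverse Δs =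
      Δ ∘L ContinuousLinearMap.adjoint γ ∘L Ring.inverse Δs -
        Δ ∘L Ring.inverse ((1 : H →L[ℂ] H) - ContinuousLinearMap.adjoint z ∘L γ) ∘L
          ContinuousLinearMap.adjoint z ∘L Δs := by
  have hzadj : ‖ContinuousLinearMap.adjoint z‖ < 1 := by
    rwa [LinearIsometryEquiv.norm_map]
  have hγadj : ‖ContinuousLinearMap.adjoint γ‖ < 1 := by
    rwa [LinearIsometryEquiv.norm_map]
  have hU : IsUnit ((1 : H →L[ℂ] H) - ContinuousLinearMap.adjoint z ∘L γ) :=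
    isUnit_one_sub_of_norm_lt_one (opNorm_comp_lt_one hzadj hγ)
  have hS : IsUnit Δs := by
    have h : IsUnit (Δs * Δs) := by
      rw [ContinuousLinearMap.mul_def, hΔssq]
      exact isUnit_one_sub_of_norm_lt_one (opNorm_comp_lt_one hγ hγadj)
    exact ((Commute.refl Δs).isUnit_mul_iff.mp h).1
  refine ⟨hU, hS, ?_⟩
  have hA := Ring.inverse_mul_cancel _ hU
  have hD := Ring.mul_inverse_cancel _ hS
  set A := Ring.inverse ((1 : H →L[ℂ] H) - ContinuousLinearMap.adjoint z ∘L γ)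
  set S := Ring.inverse Δs
  ext x
  have hx : Δs x = S x - γ (ContinuousLinearMap.adjoint γ (S x)) := by
    have h₁ := congr($hΔssq (S x))
    have h₂ : Δs (S x) = x := congr($hD x)
    simpa [h₂] using h₁
  have hy : ContinuousLinearMap.adjoint γ (S x) =
      A (ContinuousLinearMap.adjoint γ (S x)) -
        A (ContinuousLinearMap.adjoint z (γ (ContinuousLinearMap.adjoint γ (S x)))) := by
    have h := congr($hA (ContinuousLinearMap.adjoint γ (S x)))
    simpa using h.symm
  simp only [comp_apply, sub_apply, hx, map_sub]
  have hΔy := congr(Δ $hy)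
  rw [map_sub] at hΔy
  rw [hΔy]
  abel
end

section
/- Let N and M be C*-algebras, let E be a (right) Hilbert C*-module over N, and let φ : M → (bounded linear maps on E) be a unital algebra homomorphism satisfying φ(a)(ξ·b) = (φ(a)ξ)·b and ⟨φ(a)ξ, η⟩ = ⟨ξ, φ(a*)η⟩ for all a ∈ M, b ∈ N, ξ, η ∈ E. Let E₀ ⊆ E be a linear subspace with E₀·N ⊆ E₀ and φ(a)E₀ ⊆ E₀ for all a ∈ M, and let P : E → E be a linear map such that P(E) ⊆ E₀, P(η) = η for every η ∈ E₀, P(ξ·b) = P(ξ)·b for all ξ ∈ E and b ∈ N, and ‖P(ξ)‖ ≤ ‖ξ‖ for all ξ ∈ E. Then for every projection e ∈ M (e = e* = e²) and every ξ ∈ E, P(φ(e)ξ) = φ(e)P(ξ). -/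
section OrthogonalVectors

variable {N : Type*} [NonUnitalCStarAlgebra N]
  {E : Type*} [NormedAddCommGroup E] {ip : E → E → N}

/-- Pythagoras for a C⋆-algebra-valued inner product: an expanded form of `⟨x + y, x + y⟩`. -/
lemma ip_add_self_of_orthogonal
    (h_addl : ∀ ξ η ζ, ip (ξ + η) ζ = ip ξ ζ + ip η ζ)
    (h_addr : ∀ ξ η ζ, ip ξ (η + ζ) = ip ξ η + ip ξ ζ)
    (h_star : ∀ ξ η, star (ip ξ η) = ip η ξ)
    {x y : E} (hxy : ip x y = 0) : ip (x + y) (x + y) = ip x x + ip y y := by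
  have hyx : ip y x = 0 := by rw [← h_star, hxy, star_zero]
  rw [h_addl, h_addr, h_addr, hxy, hyx, add_zero, zero_add]

lemma norm_sq_eq_norm_ip_self (h_norm : ∀ ξ, ‖ξ‖ = Real.sqrt ‖ip ξ ξ‖) (x : E) :
    ‖x‖ ^ 2 = ‖ip x x‖ := by
  rw [h_norm, Real.sq_sqrt (norm_nonneg _)]

lemma norm_add_sq_le_of_orthogonal
    (h_addl : ∀ ξ η ζ, ip (ξ + η) ζ = ip ξ ζ + ip η ζ)
    (h_addr : ∀ ξ η ζ, ip ξ (η + ζ) = ip ξ η + ip ξ ζ)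
    (h_star : ∀ ξ η, star (ip ξ η) = ip η ξ)
    (h_norm : ∀ ξ, ‖ξ‖ = Real.sqrt ‖ip ξ ξ‖)
    {x y : E} (hxy : ip x y = 0) : ‖x + y‖ ^ 2 ≤ ‖x‖ ^ 2 + ‖y‖ ^ 2 := by
  simp only [norm_sq_eq_norm_ip_self h_norm]
  rw [ip_add_self_of_orthogonal h_addl h_addr h_star hxy]
  exact norm_add_le _ _

lemma norm_le_norm_add_of_orthogonal [PartialOrder N] [StarOrderedRing N]
    (h_addl : ∀ ξ η ζ, ip (ξ + η) ζ = ip ξ ζ + ip η ζ)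
    (h_addr : ∀ ξ η ζ, ip ξ (η + ζ) = ip ξ η + ip ξ ζ)
    (h_star : ∀ ξ η, star (ip ξ η) = ip η ξ)
    (h_pos : ∀ ξ, 0 ≤ ip ξ ξ)
    (h_norm : ∀ ξ, ‖ξ‖ = Real.sqrt ‖ip ξ ξ‖)
    {x y : E} (hxy : ip x y = 0) : ‖y‖ ≤ ‖x + y‖ := by
  rw [h_norm y, h_norm (x + y), ip_add_self_of_orthogonal h_addl h_addr h_star hxy]
  exact Real.sqrt_le_sqrt (CStarAlgebra.norm_le_norm_of_nonneg_of_le (h_pos y)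
    (le_add_of_nonneg_left (h_pos x)))

end OrthogonalVectors

lemma eq_zero_of_forall_one_add_sq_mul_le {a b : ℝ}
    (h : ∀ t : ℝ, (1 + t) ^ 2 * a ^ 2 ≤ b + t ^ 2 * a ^ 2) : a = 0 := by
  by_contra ha
  have ha2 : 0 < a ^ 2 := by positivity
  have := h (b / a ^ 2)
  have hb : b / a ^ 2 * a ^ 2 = b := div_mul_cancel₀ _ ha2.ne'
  have h0 := h 0
  nlinarith


/-- **Projections onto subcorrespondences are bimodule maps.**
Let `E` be a Hilbert C*-module over a C*-algebra `N` (right action `rsmul`, `N`-valued inner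
product `ip`), let `φ : M → B(E)` be a unital algebra homomorphism from a C*-algebra `M`,
commuting with the right action and adjointable with respect to `ip`. If `E₀ ⊆ E` is a
subspace invariant under the right `N`-action and under every `φ(a)`, and `P : E → E` is a
contractive linear right-module map with range in `E₀` fixing `E₀` pointwise, then
`P(φ(e)ξ) = φ(e)(P ξ)` for every projection `e ∈ M` and every `ξ ∈ E`. -/
theorem stmt6
    {M : Type*} [CStarAlgebra M]
    {N : Type*} [NonUnitalCStarAlgebra N] [PartialOrder N] [StarOrderedRing N]
    {E : Type*} [NormedAddCommGroup E] [NormedSpace ℂ E] [CompleteSpace E]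
    (rsmul : E → N → E) (ip : E → E → N)
    -- `E` is a right `N`-module:
    (h_rsmul_addl : ∀ ξ η b, rsmul (ξ + η) b = rsmul ξ b + rsmul η b)
    (h_rsmul_addr : ∀ ξ b c, rsmul ξ (b + c) = rsmul ξ b + rsmul ξ c)
    (h_rsmul_mul : ∀ ξ b c, rsmul (rsmul ξ b) c = rsmul ξ (b * c))
    -- `ip` is an `N`-valued inner product making `E` a Hilbert C*-module:
    (h_ip_addl : ∀ ξ η ζ, ip (ξ + η) ζ = ip ξ ζ + ip η ζ)
    (h_ip_addr : ∀ ξ η ζ, ip ξ (η + ζ) = ip ξ η + ip ξ ζ)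
    (h_ip_smul : ∀ ξ η b, ip ξ (rsmul η b) = ip ξ η * b)
    (h_ip_star : ∀ ξ η, star (ip ξ η) = ip η ξ)
    (h_ip_pos : ∀ ξ, 0 ≤ ip ξ ξ)
    (h_ip_defn : ∀ ξ, ip ξ ξ = 0 → ξ = 0)
    (h_norm : ∀ ξ, ‖ξ‖ = Real.sqrt ‖ip ξ ξ‖)
    -- the left action of `M`:
    (φ : M →ₐ[ℂ] (E →L[ℂ] E))
    (hφ_mod : ∀ a ξ b, φ a (rsmul ξ b) = rsmul (φ a ξ) b)
    (hφ_adj : ∀ a ξ η, ip (φ a ξ) η = ip ξ (φ (star a) η))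
    -- the subcorrespondence `E₀`:
    (E₀ : Submodule ℂ E)
    (hE₀_rsmul : ∀ ξ ∈ E₀, ∀ b, rsmul ξ b ∈ E₀)
    (hE₀_φ : ∀ (a : M), ∀ ξ ∈ E₀, φ a ξ ∈ E₀)
    -- the projection `P` onto `E₀`:
    (P : E →ₗ[ℂ] E)
    (hP_range : ∀ ξ, P ξ ∈ E₀)
    (hP_fix : ∀ ξ ∈ E₀, P ξ = ξ)
    (hP_mod : ∀ ξ b, P (rsmul ξ b) = rsmul (P ξ) b)
    (hP_contr : ∀ ξ, ‖P ξ‖ ≤ ‖ξ‖) :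
    ∀ e : M, IsSelfAdjoint e → e * e = e → ∀ ξ, P (φ e ξ) = φ e (P ξ) := by
  have ip_zero (ξ : E) : ip ξ 0 = 0 := by simpa using h_ip_addr ξ 0 0
  have orth (e : M) (he : IsSelfAdjoint e) (hee : e * e = e) (ξ η : E) :
      ip (φ e ξ) (φ (1 - e) η) = 0 := by
    rw [hφ_adj, he.star_eq, ← mul_apply_eq_comp, ← map_mul, mul_sub, mul_one, hee,
      sub_self, map_zero, zero_apply, ip_zero]
  have split (e : M) (ξ : E) : φ e ξ + φ (1 - e) ξ = ξ := by simp
  have corner (e : M) (he : IsSelfAdjoint e) (hee : e * e = e) (ξ : E) :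
      φ (1 - e) (P (φ e ξ)) = 0 := by
    have idem : (1 - e) * (1 - e) = 1 - e := by
      simp only [mul_sub, sub_mul, mul_one, one_mul, hee, sub_self, sub_zero]
    set x := φ e ξ with hx
    set y := φ (1 - e) (P x) with hy
    have hPy : P y = y := hP_fix _ (hE₀_φ _ _ (hP_range _))
    have hfy : φ (1 - e) y = y := by
      rw [hy, ← mul_apply_eq_comp, ← map_mul, idem]
    refine norm_eq_zero.mp (eq_zero_of_forall_one_add_sq_mul_le (b := ‖x‖ ^ 2) fun t => ?_)
    have lower : ‖(1 + t : ℂ) • y‖ ≤ ‖x + (t : ℂ) • y‖ := by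
      calc ‖(1 + t : ℂ) • y‖ = ‖φ (1 - e) (P (x + (t : ℂ) • y))‖ := by
            rw [map_add, map_smul, hPy, map_add, map_smul, hfy, ← hy, add_smul, one_smul]
        _ ≤ ‖φ e (P (x + (t : ℂ) • y)) + φ (1 - e) (P (x + (t : ℂ) • y))‖ :=
            norm_le_norm_add_of_orthogonal h_ip_addl h_ip_addr h_ip_star h_ip_pos h_norm
              (orth e he hee _ _)
        _ = ‖P (x + (t : ℂ) • y)‖ := by rw [split]
        _ ≤ ‖x + (t : ℂ) • y‖ := hP_contr _
    have upper : ‖x + (t : ℂ) • y‖ ^ 2 ≤ ‖x‖ ^ 2 + ‖(t : ℂ) • y‖ ^ 2 := by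
      refine norm_add_sq_le_of_orthogonal h_ip_addl h_ip_addr h_ip_star h_norm ?_
      rw [hy, ← map_smul]
      exact orth e he hee _ _
    have norm_one_add : ‖(1 + t : ℂ)‖ ^ 2 = (1 + t) ^ 2 := by
      rw [← Complex.ofReal_one, ← Complex.ofReal_add, Complex.norm_real, Real.norm_eq_abs, sq_abs]
    calc (1 + t) ^ 2 * ‖y‖ ^ 2 = ‖(1 + t : ℂ) • y‖ ^ 2 := by
          rw [norm_smul, mul_pow, norm_one_add]
      _ ≤ ‖x + (t : ℂ) • y‖ ^ 2 := by gcongr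
      _ ≤ ‖x‖ ^ 2 + ‖(t : ℂ) • y‖ ^ 2 := upper
      _ = ‖x‖ ^ 2 + t ^ 2 * ‖y‖ ^ 2 := by
          rw [norm_smul, mul_pow, Complex.norm_real, Real.norm_eq_abs, sq_abs]
  intro e he hee ξ
  have h₁ : φ (1 - e) (P (φ e ξ)) = 0 := corner e he hee ξ
  have h₂ : φ e (P (φ (1 - e) ξ)) = 0 := by
    have := corner (1 - e) ((IsSelfAdjoint.one M).sub he)
      (by simp only [mul_sub, sub_mul, mul_one, one_mul, hee, sub_self, sub_zero]) ξ
    rwa [sub_sub_cancel] at this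
  calc P (φ e ξ) = φ e (P (φ e ξ)) := by
          conv_lhs => rw [← split e (P (φ e ξ)), h₁, add_zero]
    _ = φ e (P (φ e ξ + φ (1 - e) ξ)) := by rw [map_add, map_add, h₂, add_zero]
    _ = φ e (P ξ) := by rw [split]
end
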